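/- For every initial state x(0) ∈ ({−1,+1}^d)^N, the sequence defined by x(t+1) = T(x(t)) is eventually constant: there exists t₀ such that x(t) = x(t₀) for all t ≥ t₀ and x(t₀) is a fixed point of T. In other words, the recurrent correlation neural network with split-sign activation on d-dimensional hypercomplex states (e.g., the octonion-valued model with d = 8) always settles at an equilibrium under synchronous update. -/

import Mathlib

open scoped Classical

/-- Correlation `Σ_i ⟪u_i^ξ, x_i⟫` of a state with the `ξ`-th fundamental memory,
where `⟪·,·⟫` is the Euclidean inner product on `ℝ^d`. -/
noncomputable def sOverlap {d N P : ℕ} (u : Fin P → Fin N → Fin d → ℝ)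
    (x : Fin N → Fin d → ℝ) (ξ : Fin P) : ℝ :=
  ∑ i, ∑ j, u ξ i j * x i j

/-- Activation potential `h_i(x) = Σ_ξ w_ξ(x)·u_i^ξ ∈ ℝ^d` with
`w_ξ(x) = f(sOverlap u x ξ)`. -/
noncomputable def sPot {d N P : ℕ} (f : ℝ → ℝ) (u : Fin P → Fin N → Fin d → ℝ)
    (x : Fin N → Fin d → ℝ) (i : Fin N) : Fin d → ℝ :=
  fun j => ∑ ξ, f (sOverlap u x ξ) * u ξ i j

/-- Synchronous update of the RCNN with componentwise split-sign activation:
neuron `i` becomes the componentwise sign of `h_i(x)` whenever all components of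
`h_i(x)` are nonzero, and keeps its state otherwise. -/
noncomputable def sUpd {d N P : ℕ} (f : ℝ → ℝ) (u : Fin P → Fin N → Fin d → ℝ)
    (x : Fin N → Fin d → ℝ) : Fin N → Fin d → ℝ :=
  fun i => if ∀ j, sPot f u x i j ≠ 0 then (fun j => Real.sign (sPot f u x i j)) else x i

theorem aux_convex (f F : ℝ → ℝ) (hmono : Monotone f)
    (hF : ∀ t : ℝ, HasDerivAt F (f t) t) (a b : ℝ) : f a * (b - a) ≤ F b - F a := by
  have hc : Continuous F := continuous_iff_continuousAt.2 fun t => (hF t).continuousAt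
  rcases lt_trichotomy a b with h | h | h
  · obtain ⟨c, hc1, hc2⟩ := exists_hasDerivAt_eq_slope F f h hc.continuousOn (fun t _ => hF t)
    have h1 := hmono hc1.1.le
    have hba : 0 < b - a := sub_pos.2 h
    rw [eq_div_iff hba.ne'] at hc2
    nlinarith
  · subst h; simp
  · obtain ⟨c, hc1, hc2⟩ := exists_hasDerivAt_eq_slope F f h hc.continuousOn (fun t _ => hF t)
    have h1 := hmono hc1.2.le
    have hba : 0 < a - b := sub_pos.2 h
    rw [eq_div_iff hba.ne'] at hc2
    nlinarith

theorem aux_sign {h x : ℝ} (hh : h ≠ 0) (hx : x = 1 ∨ x = -1) :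
    0 ≤ h * (Real.sign h - x) ∧ (Real.sign h ≠ x → 0 < h * (Real.sign h - x)) := by
  rcases lt_or_gt_of_ne hh with h0 | h0
  · rw [Real.sign_of_neg h0]
    rcases hx with rfl | rfl
    · constructor <;> intros <;> nlinarith
    · simp
  · rw [Real.sign_of_pos h0]
    rcases hx with rfl | rfl
    · simp
    · constructor <;> intros <;> nlinarith

theorem aux_pm {d N P : ℕ} (f : ℝ → ℝ) (u : Fin P → Fin N → Fin d → ℝ)
    (x : Fin N → Fin d → ℝ) (hx : ∀ i j, x i j = 1 ∨ x i j = -1) :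
    ∀ i j, sUpd f u x i j = 1 ∨ sUpd f u x i j = -1 := by
  intro i j
  unfold sUpd
  split_ifs with h
  · rcases Real.sign_apply_eq_of_ne_zero _ (h j) with h | h <;> simp [h]
  · exact hx i j

theorem aux_term {d N P : ℕ} (f : ℝ → ℝ) (u : Fin P → Fin N → Fin d → ℝ)
    (x : Fin N → Fin d → ℝ) (hx : ∀ i j, x i j = 1 ∨ x i j = -1) (i : Fin N) (j : Fin d) :
    0 ≤ sPot f u x i j * (sUpd f u x i j - x i j) ∧
    (sUpd f u x i j ≠ x i j → 0 < sPot f u x i j * (sUpd f u x i j - x i j)) := by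
  by_cases h : ∀ j, sPot f u x i j ≠ 0
  · have e : sUpd f u x i j = Real.sign (sPot f u x i j) := by
      unfold sUpd; rw [if_pos h]
    rw [e]
    exact aux_sign (h j) (hx i j)
  · have e : sUpd f u x i j = x i j := by
      unfold sUpd; rw [if_neg h]
    simp [e]

theorem aux_energy {d N P : ℕ} (f F : ℝ → ℝ) (hmono : Monotone f)
    (hF : ∀ t : ℝ, HasDerivAt F (f t) t) (u : Fin P → Fin N → Fin d → ℝ)
    (x : Fin N → Fin d → ℝ) (hx : ∀ i j, x i j = 1 ∨ x i j = -1) (hne : sUpd f u x ≠ x) :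
    ∑ ξ, F (sOverlap u x ξ) < ∑ ξ, F (sOverlap u (sUpd f u x) ξ) := by
  have h1 : ∑ ξ, f (sOverlap u x ξ) * (sOverlap u (sUpd f u x) ξ - sOverlap u x ξ) ≤
      ∑ ξ, (F (sOverlap u (sUpd f u x) ξ) - F (sOverlap u x ξ)) :=
    Finset.sum_le_sum fun ξ _ => aux_convex f F hmono hF _ _
  have h2 : ∑ ξ, f (sOverlap u x ξ) * (sOverlap u (sUpd f u x) ξ - sOverlap u x ξ) =
      ∑ i, ∑ j, sPot f u x i j * (sUpd f u x i j - x i j) := by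
    have e : ∀ ξ, f (sOverlap u x ξ) * (sOverlap u (sUpd f u x) ξ - sOverlap u x ξ) =
        ∑ i, ∑ j, f (sOverlap u x ξ) * u ξ i j * (sUpd f u x i j - x i j) := by
      intro ξ
      have e' : sOverlap u (sUpd f u x) ξ - sOverlap u x ξ =
          ∑ i, ∑ j, u ξ i j * (sUpd f u x i j - x i j) := by
        simp only [sOverlap, mul_sub, Finset.sum_sub_distrib]
      rw [e']
      simp only [Finset.mul_sum, mul_assoc]
    simp only [e]
    rw [Finset.sum_comm]
    refine Finset.sum_congr rfl fun i _ => ?_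
    rw [Finset.sum_comm]
    refine Finset.sum_congr rfl fun j _ => ?_
    rw [sPot, Finset.sum_mul]
  have h3 : 0 < ∑ i, ∑ j, sPot f u x i j * (sUpd f u x i j - x i j) := by
    obtain ⟨i, hi⟩ := Function.ne_iff.1 hne
    obtain ⟨j, hj⟩ := Function.ne_iff.1 hi
    have ht := aux_term f u x hx
    exact Finset.sum_pos' (fun i _ => Finset.sum_nonneg fun j _ => (ht i j).1)
      ⟨i, Finset.mem_univ _, Finset.sum_pos' (fun j _ => (ht i j).1)
        ⟨j, Finset.mem_univ _, (ht i j).2 hj⟩⟩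
  rw [Finset.sum_sub_distrib] at h1
  linarith

/-- The RCNN with split-sign activation on `d`-dimensional hypercomplex states (e.g.,
the octonion-valued model with `d = 8`) always settles at an equilibrium under
synchronous update. -/
theorem splitSign_sync_settles {d N P : ℕ} (hd : 1 ≤ d) (hN : 1 ≤ N) (hP : 1 ≤ P)
    (f F : ℝ → ℝ) (hf : Continuous f) (hmono : Monotone f)
    (hF : ∀ t : ℝ, HasDerivAt F (f t) t)
    (u : Fin P → Fin N → Fin d → ℝ) (hu : ∀ ξ i j, u ξ i j = 1 ∨ u ξ i j = -1)
    (x₀ : Fin N → Fin d → ℝ) (hx₀ : ∀ i j, x₀ i j = 1 ∨ x₀ i j = -1) :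
    ∃ t₀ : ℕ, sUpd f u ((sUpd f u)^[t₀] x₀) = (sUpd f u)^[t₀] x₀ ∧
      ∀ t : ℕ, t₀ ≤ t → (sUpd f u)^[t] x₀ = (sUpd f u)^[t₀] x₀ := by
  have hpm : ∀ t : ℕ, ∀ i j, (sUpd f u)^[t] x₀ i j = 1 ∨ (sUpd f u)^[t] x₀ i j = -1 := by
    intro t
    induction t with
    | zero => exact hx₀
    | succ n ih =>
      rw [Function.iterate_succ_apply']
      exact aux_pm f u _ ih
  have hex : ∃ t₀ : ℕ, sUpd f u ((sUpd f u)^[t₀] x₀) = (sUpd f u)^[t₀] x₀ := by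
    by_contra! hcon
    have hs : StrictMono fun t : ℕ => ∑ ξ, F (sOverlap u ((sUpd f u)^[t] x₀) ξ) := by
      refine strictMono_nat_of_lt_succ fun n => ?_
      rw [Function.iterate_succ_apply']
      exact aux_energy f F hmono hF u _ (hpm n) (hcon n)
    have hinj : Function.Injective fun t : ℕ => (sUpd f u)^[t] x₀ := by
      intro a b hab
      apply hs.injective
      simp only at hab ⊢
      rw [hab]
    have hfin : {x : Fin N → Fin d → ℝ | ∀ i, x i ∈ {y : Fin d → ℝ | ∀ j, y j ∈ ({1, -1} : Set ℝ)}}.Finite :=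
      Set.Finite.pi' fun _ => Set.Finite.pi' fun _ => Set.toFinite _
    refine Set.infinite_of_injective_forall_mem hinj ?_ hfin
    intro t i j
    simpa using hpm t i j
  obtain ⟨t₀, ht⟩ := hex
  refine ⟨t₀, ht, fun t htt => ?_⟩
  induction t, htt using Nat.le_induction with
  | base => rfl
  | succ n _ ih => rw [Function.iterate_succ_apply', ih, ht]
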